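/- Let (X, μ) be a probability space and let (h_n) be a sequence of measurable functions converging almost everywhere to a measurable function h, with ∫ log(1+|h|) dμ < ∞ and ∫ log(1+|h_n|) dμ < ∞ for all n. Then ∫ log(1+|h_n − h|) dμ → 0 if and only if ∫ log(1+|h_n|) dμ → ∫ log(1+|h|) dμ. -/

import Mathlib

open MeasureTheory Filter

lemma L0_log_subadd (a b : ℂ) :
    Real.log (1 + ‖a + b‖) ≤ Real.log (1 + ‖a‖) + Real.log (1 + ‖b‖) := by
  have ha := norm_nonneg a
  have hb := norm_nonneg b
  have hab := norm_add_le a b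
  rw [← Real.log_mul (by positivity) (by positivity)]
  apply Real.log_le_log (by positivity)
  nlinarith [mul_nonneg ha hb]

lemma L0_log_tendsto {u : ℕ → ℂ} {a : ℂ} (hu : Tendsto u atTop (nhds a)) :
    Tendsto (fun n => Real.log (1 + ‖u n‖)) atTop (nhds (Real.log (1 + ‖a‖))) :=
  (hu.norm.const_add 1).log (by positivity)

/-- On a probability space, for a sequence `h n` converging a.e. to `h`, with all the
functions in `L⁰` (i.e. `∫ log(1+|·|) < ∞`), one has `∫ log(1+|h n − h|) → 0` iff
`∫ log(1+|h n|) → ∫ log(1+|h|)`. -/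
theorem L0_convergence_iff {X : Type*} [MeasurableSpace X]
    (μ : Measure X) [IsProbabilityMeasure μ]
    (h : ℕ → X → ℂ) (H : X → ℂ)
    (hm : ∀ n, Measurable (h n)) (hM : Measurable H)
    (hint : ∀ n, Integrable (fun x => Real.log (1 + ‖h n x‖)) μ)
    (hInt : Integrable (fun x => Real.log (1 + ‖H x‖)) μ)
    (hae : ∀ᵐ x ∂μ, Tendsto (fun n => h n x) atTop (nhds (H x))) :
    Tendsto (fun n => ∫ x, Real.log (1 + ‖h n x - H x‖) ∂μ) atTop (nhds 0) ↔
      Tendsto (fun n => ∫ x, Real.log (1 + ‖h n x‖) ∂μ) atTop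
        (nhds (∫ x, Real.log (1 + ‖H x‖) ∂μ)) := by
  have nonneg : ∀ z : ℂ, 0 ≤ Real.log (1 + ‖z‖) := fun z =>
    Real.log_nonneg (by linarith [norm_nonneg z])
  have sub1 : ∀ a b : ℂ, Real.log (1 + ‖a - b‖) ≤ Real.log (1 + ‖a‖) + Real.log (1 + ‖b‖) := by
    intro a b
    simpa [sub_eq_add_neg] using L0_log_subadd a (-b)
  have sub2 : ∀ a b : ℂ, Real.log (1 + ‖a‖) ≤ Real.log (1 + ‖a - b‖) + Real.log (1 + ‖b‖) := by
    intro a b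
    simpa using L0_log_subadd (a - b) b
  have meas : ∀ n, Measurable (fun x => Real.log (1 + ‖h n x - H x‖)) := fun n =>
    Real.measurable_log.comp (measurable_const.add ((hm n).sub hM).norm)
  have intd : ∀ n, Integrable (fun x => Real.log (1 + ‖h n x - H x‖)) μ := by
    intro n
    refine ((hint n).add hInt).mono' (meas n).aestronglyMeasurable (ae_of_all _ fun x => ?_)
    rw [Real.norm_of_nonneg (nonneg _)]
    exact sub1 _ _
  have key : Tendsto
      (fun n => ∫ x, (Real.log (1 + ‖h n x - H x‖) - Real.log (1 + ‖h n x‖)) ∂μ) atTop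
      (nhds (∫ x, - Real.log (1 + ‖H x‖) ∂μ)) := by
    refine tendsto_integral_of_dominated_convergence (fun x => Real.log (1 + ‖H x‖))
      (fun n => ((intd n).sub (hint n)).aestronglyMeasurable) hInt
      (fun n => ae_of_all _ fun x => ?_) ?_
    · rw [Real.norm_eq_abs, abs_le]
      constructor
      · linarith [sub2 (h n x) (H x)]
      · linarith [sub1 (h n x) (H x)]
    · filter_upwards [hae] with x hx
      have h1 : Tendsto (fun n => h n x - H x) atTop (nhds 0) := by
        simpa using hx.sub_const (H x)
      simpa using (L0_log_tendsto h1).sub (L0_log_tendsto hx)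
  rw [integral_neg] at key
  simp_rw [fun n => integral_sub (intd n) (hint n)] at key
  constructor
  · intro hA
    simpa using hA.sub key
  · intro hB
    simpa using key.add hB
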